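/- arXiv:1805.02373 — 4 statements merged into one kernel-verified Lean document; each statement's English description precedes it below -/
import Mathlib

section
/- (Barrier estimate for harmonic functions on a finite strip.) Let Θ > 2 and M ≥ 0 be real numbers. Let h : [0,1] × [-Θ, Θ] → ℝ be continuous on the closed rectangle and harmonic in the open rectangle (0,1) × (-Θ, Θ), i.e. twice continuously differentiable there with ∂²h/∂t² + ∂²h/∂θ² = 0. Assume h(0, θ) = h(1, θ) = 0 for all |θ| ≤ Θ, and |h(t, ±Θ)| ≤ M for all t ∈ [0,1]. Then for every (t, θ) ∈ [0,1] × [-2,2], |h(t, θ)| ≤ w(t, θ) where w(t, θ) = 2M sin(π/4 + πt/2) cosh(πθ/2)/cosh(πΘ/2); in particular |h(t, θ)| ≤ 2 cosh(π) M / cosh(πΘ/2) on [0,1] × [-2,2], a bound that tends to 0 as Θ → ∞. -/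
open Set Real Filter

/-- The Laplacian `∂²h/∂t² + ∂²h/∂θ²` of a function on `ℝ²`, computed via
slice (partial) second derivatives. -/
noncomputable def lap2 (h : ℝ × ℝ → ℝ) (p : ℝ × ℝ) : ℝ :=
  deriv (deriv (fun s => h (s, p.2))) p.1 + deriv (deriv (fun s => h (p.1, s))) p.2

lemma second_deriv_nonpos {f : ℝ → ℝ} {a : ℝ} (hm : IsLocalMax f a) (hc : ContinuousAt f a) :
    deriv (deriv f) a ≤ 0 := by
  by_contra hcon
  push Not at hcon
  have h1 : IsLocalMin f a := isLocalMin_of_deriv_deriv_pos hcon hm.deriv_eq_zero hc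
  have h2 : f =ᶠ[nhds a] fun _ => f a := by
    filter_upwards [hm, h1] with x hx hx'
    exact le_antisymm hx hx'
  have h3 : deriv (deriv f) a = 0 := by
    rw [h2.deriv.deriv_eq]
    simp
  linarith

lemma deriv2_add {f g : ℝ → ℝ} {a : ℝ} (hf : ContDiffAt ℝ 2 f a) (hg : ContDiffAt ℝ 2 g a) :
    deriv (deriv (fun s => f s + g s)) a = deriv (deriv f) a + deriv (deriv g) a := by
  have := iteratedDeriv_fun_add (n := 2) (by exact_mod_cast hf) (by exact_mod_cast hg)
  simpa [iteratedDeriv_succ, iteratedDeriv_zero] using this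

lemma lap2_add {f g : ℝ × ℝ → ℝ} {p : ℝ × ℝ} (hf : ContDiffAt ℝ 2 f p) (hg : ContDiffAt ℝ 2 g p) :
    lap2 (fun q => f q + g q) p = lap2 f p + lap2 g p := by
  obtain ⟨a, b⟩ := p
  have s1 : ContDiffAt ℝ 2 (fun s : ℝ => (s, b)) a := by fun_prop
  have s2 : ContDiffAt ℝ 2 (fun s : ℝ => (a, s)) b := by fun_prop
  have e1 := deriv2_add (f := fun s => f (s, b)) (g := fun s => g (s, b))
    (ContDiffAt.comp a hf s1) (ContDiffAt.comp a hg s1)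
  have e2 := deriv2_add (f := fun s => f (a, s)) (g := fun s => g (a, s))
    (ContDiffAt.comp b hf s2) (ContDiffAt.comp b hg s2)
  simp only [lap2]
  rw [e1, e2]; ring

lemma max_principle {Θ C : ℝ} {F : ℝ × ℝ → ℝ} 
    (hcont : ContinuousOn F (Icc (0:ℝ) 1 ×ˢ Icc (-Θ) Θ))
    (hlap : ∀ p ∈ Ioo (0:ℝ) 1 ×ˢ Ioo (-Θ) Θ, 0 < lap2 F p)
    (hb1 : ∀ θ ∈ Icc (-Θ) Θ, F (0, θ) ≤ C ∧ F (1, θ) ≤ C)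
    (hb2 : ∀ t ∈ Icc (0:ℝ) 1, F (t, Θ) ≤ C ∧ F (t, -Θ) ≤ C) :
    ∀ p ∈ Icc (0:ℝ) 1 ×ˢ Icc (-Θ) Θ, F p ≤ C := by
  intro q hq
  obtain ⟨⟨a, b⟩, hp, hmax⟩ :=
    (isCompact_Icc.prod isCompact_Icc).exists_isMaxOn ⟨q, hq⟩ hcont
  refine (hmax hq).trans ?_
  obtain ⟨ha, hb⟩ := hp
  simp only at ha hb
  change F (a, b) ≤ C
  rcases eq_or_lt_of_le ha.1 with h | ha1
  · rw [← h]; exact (hb1 b hb).1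
  rcases eq_or_lt_of_le ha.2 with h | ha2
  · rw [h]; exact (hb1 b hb).2
  rcases eq_or_lt_of_le hb.1 with h | hb1
  · rw [← h]; exact (hb2 a ha).2
  rcases eq_or_lt_of_le hb.2 with h | hb2
  · rw [h]; exact (hb2 a ha).1
  exfalso
  have hnh : Icc (0:ℝ) 1 ×ˢ Icc (-Θ) Θ ∈ nhds (a, b) :=
    prod_mem_nhds (Icc_mem_nhds ha1 ha2) (Icc_mem_nhds hb1 hb2)
  have hloc : IsLocalMax F (a, b) := hmax.isLocalMax hnh
  have hca : ContinuousAt F (a, b) := hcont.continuousAt hnh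
  have s1 : ContinuousAt (fun s : ℝ => (s, b)) a := by fun_prop
  have s2 : ContinuousAt (fun s : ℝ => (a, s)) b := by fun_prop
  have e1 := second_deriv_nonpos (f := fun s => F (s, b)) (a := a)
    (s1.eventually hloc) (ContinuousAt.comp (f := fun s : ℝ => (s, b)) hca s1)
  have e2 := second_deriv_nonpos (f := fun s => F (a, s)) (a := b)
    (s2.eventually hloc) (ContinuousAt.comp (f := fun s : ℝ => (a, s)) hca s2)
  have := hlap (a, b) ⟨⟨ha1, ha2⟩, hb1, hb2⟩
  simp only [lap2] at this
  linarith

lemma lap2_barrier (K ε : ℝ) (p : ℝ × ℝ) :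
    lap2 (fun q => ε * q.1 ^ 2 - K * Real.sin (π/4 + π * q.1 / 2) * Real.cosh (π * q.2 / 2)) p
      = 2 * ε := by
  obtain ⟨a, b⟩ := p
  have l : ∀ s : ℝ, HasDerivAt (fun s : ℝ => π * s / 2) (π / 2) s := fun s => by
    simpa using ((hasDerivAt_id s).const_mul π).div_const 2
  have l' : ∀ s : ℝ, HasDerivAt (fun s : ℝ => π/4 + π * s / 2) (π / 2) s := fun s => by
    simpa using (l s).const_add (π/4)
  have d1 : deriv (fun s : ℝ => ε * s ^ 2 - K * Real.sin (π/4 + π * s / 2) * Real.cosh (π * b / 2))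
      = fun s => ε * (2 * s) - K * (Real.cos (π/4 + π * s / 2) * (π/2)) * Real.cosh (π * b / 2) := by
    funext s
    refine HasDerivAt.deriv ?_
    have := ((hasDerivAt_pow 2 s).const_mul ε).fun_sub (((l' s).sin.const_mul K).mul_const (Real.cosh (π * b / 2)))
    simpa using this
  have d2 : deriv (fun s : ℝ => ε * (2 * s) - K * (Real.cos (π/4 + π * s / 2) * (π/2)) * Real.cosh (π * b / 2)) a
      = ε * 2 - K * (-Real.sin (π/4 + π * a / 2) * (π/2) * (π/2)) * Real.cosh (π * b / 2) := by
    refine HasDerivAt.deriv ?_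
    have := (((hasDerivAt_id a).const_mul 2).const_mul ε).fun_sub
      ((((l' a).cos.mul_const (π/2)).const_mul K).mul_const (Real.cosh (π * b / 2)))
    simpa using this
  have d3 : deriv (fun s : ℝ => ε * a ^ 2 - K * Real.sin (π/4 + π * a / 2) * Real.cosh (π * s / 2))
      = fun s => -(K * Real.sin (π/4 + π * a / 2) * (Real.sinh (π * s / 2) * (π/2))) := by
    funext s
    refine HasDerivAt.deriv ?_
    exact ((l s).cosh.const_mul (K * Real.sin (π/4 + π * a / 2))).const_sub (ε * a ^ 2)
  have d4 : deriv (fun s : ℝ => -(K * Real.sin (π/4 + π * a / 2) * (Real.sinh (π * s / 2) * (π/2)))) b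
      = -(K * Real.sin (π/4 + π * a / 2) * (Real.cosh (π * b / 2) * (π/2) * (π/2))) := by
    refine HasDerivAt.deriv ?_
    exact (((l b).sinh.mul_const (π/2)).const_mul (K * Real.sin (π/4 + π * a / 2))).neg
  simp only [lap2]
  rw [d1, d2, d3, d4]
  ring

lemma sin_lower {t : ℝ} (ht : t ∈ Icc (0:ℝ) 1) : 1 ≤ 2 * Real.sin (π/4 + π * t / 2) := by
  have hp := Real.pi_pos
  have h1 : Real.sin (π/4) ≤ Real.sin (π/4 + π * t / 2) := by
    have e : π/4 + π * t / 2 = π/2 - (π/4 - π*t/2) := by ring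
    rw [e, Real.sin_pi_div_two_sub, ← Real.cos_abs]
    have : Real.sin (π/4) = Real.cos (π/4) := by simp
    rw [this]
    apply Real.cos_le_cos_of_nonneg_of_le_pi (abs_nonneg _) (by linarith)
    rw [abs_le]
    constructor <;> nlinarith [ht.1, ht.2]
  rw [Real.sin_pi_div_four] at h1
  have : (1:ℝ) ≤ √2 := Real.one_le_sqrt.2 (by norm_num)
  linarith

lemma one_sided (Θ M : ℝ) (hM : 0 ≤ M)
    (h : ℝ × ℝ → ℝ)
    (hcont : ContinuousOn h (Icc (0:ℝ) 1 ×ˢ Icc (-Θ) Θ))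
    (hC2 : ContDiffOn ℝ 2 h (Ioo (0:ℝ) 1 ×ˢ Ioo (-Θ) Θ))
    (hharm : ∀ p ∈ Ioo (0:ℝ) 1 ×ˢ Ioo (-Θ) Θ, lap2 h p = 0)
    (hbc : ∀ θ ∈ Icc (-Θ) Θ, h (0, θ) ≤ 0 ∧ h (1, θ) ≤ 0)
    (hside : ∀ t ∈ Icc (0:ℝ) 1, h (t, Θ) ≤ M ∧ h (t, -Θ) ≤ M)
    (t : ℝ) (ht : t ∈ Icc (0:ℝ) 1) (θ : ℝ) (hθ : θ ∈ Icc (-Θ) Θ) :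
    h (t, θ) ≤ 2 * M * Real.sin (π/4 + π * t / 2) *
          Real.cosh (π * θ / 2) / Real.cosh (π * Θ / 2) := by
  have hcp := Real.cosh_pos (π * Θ / 2)
  set K := 2 * M / Real.cosh (π * Θ / 2) with hK
  have hK0 : 0 ≤ K := by positivity
  have hKc : K * Real.cosh (π * Θ / 2) = 2 * M := by rw [hK]; field_simp
  have goal_eq : 2 * M * Real.sin (π/4 + π * t / 2) *
          Real.cosh (π * θ / 2) / Real.cosh (π * Θ / 2)
      = K * Real.sin (π/4 + π * t / 2) * Real.cosh (π * θ / 2) := by rw [hK]; ring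
  rw [goal_eq]
  refine le_of_forall_pos_le_add fun ε hε => ?_
  have hbar : ContDiff ℝ 2 (fun q : ℝ × ℝ =>
      ε * q.1 ^ 2 - K * Real.sin (π/4 + π * q.1 / 2) * Real.cosh (π * q.2 / 2)) := by
    have c1 : ContDiff ℝ 2 (fun q : ℝ × ℝ => Real.sin (π/4 + π * q.1 / 2)) :=
      Real.contDiff_sin.comp (by fun_prop)
    have c2 : ContDiff ℝ 2 (fun q : ℝ × ℝ => Real.cosh (π * q.2 / 2)) :=
      Real.contDiff_cosh.comp (by fun_prop)
    fun_prop
  have hpos : ∀ s ∈ Icc (0:ℝ) 1, ∀ r : ℝ,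
      0 ≤ K * Real.sin (π/4 + π * s / 2) * Real.cosh (π * r / 2) := fun s hs r => by
    have := sin_lower hs
    have := Real.cosh_pos (π * r / 2)
    have : 0 ≤ Real.sin (π/4 + π * s / 2) := by linarith
    positivity
  have hend : ∀ s ∈ Icc (0:ℝ) 1,
      M ≤ K * Real.sin (π/4 + π * s / 2) * Real.cosh (π * Θ / 2) := fun s hs => by
    have := sin_lower hs
    rw [mul_right_comm, hKc]
    nlinarith
  have hsq : ∀ s ∈ Icc (0:ℝ) 1, ε * s ^ 2 ≤ ε := fun s hs => by
    have : s ^ 2 ≤ 1 := by nlinarith [hs.1, hs.2]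
    nlinarith
  have key := max_principle (Θ := Θ) (C := ε) (F := fun q => h q + 
      (ε * q.1 ^ 2 - K * Real.sin (π/4 + π * q.1 / 2) * Real.cosh (π * q.2 / 2)))
    (hcont.add hbar.continuous.continuousOn) ?_ ?_ ?_ (t, θ) ⟨ht, hθ⟩
  · simp only at key
    nlinarith [sq_nonneg t]
  · intro p hp
    rw [lap2_add (hC2.contDiffAt ((isOpen_Ioo.prod isOpen_Ioo).mem_nhds hp)) hbar.contDiffAt,
      hharm p hp, lap2_barrier]
    linarith
  · intro r hr
    have m0 : (0:ℝ) ∈ Icc (0:ℝ) 1 := by simp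
    have m1 : (1:ℝ) ∈ Icc (0:ℝ) 1 := by simp
    have := hbc r hr
    have := hpos 0 m0 r
    have := hpos 1 m1 r
    have := hsq 0 m0
    have := hsq 1 m1
    constructor <;> simp only <;> linarith
  · intro s hs
    have := hside s hs
    have := hend s hs
    have := hsq s hs
    have e : Real.cosh (π * -Θ / 2) = Real.cosh (π * Θ / 2) := by
      rw [← Real.cosh_neg]; congr 1; ring
    constructor <;> simp only [e] <;> linarith

/-- Barrier estimate for harmonic functions on the finite strip
`[0,1] × [-Θ,Θ]` vanishing on `{t = 0,1}` and bounded by `M` on the ends: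
on `[0,1] × [-2,2]` one has `|h| ≤ 2M sin(π/4 + πt/2) cosh(πθ/2)/cosh(πΘ/2)`,
in particular `|h| ≤ 2 cosh(π) M / cosh(πΘ/2)`, a bound tending to `0` as
`Θ → ∞`. -/
theorem strip_barrier_estimate (Θ M : ℝ) (hΘ : 2 < Θ) (hM : 0 ≤ M)
    (h : ℝ × ℝ → ℝ)
    (hcont : ContinuousOn h (Icc (0:ℝ) 1 ×ˢ Icc (-Θ) Θ))
    (hC2 : ContDiffOn ℝ 2 h (Ioo (0:ℝ) 1 ×ˢ Ioo (-Θ) Θ))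
    (hharm : ∀ p ∈ Ioo (0:ℝ) 1 ×ˢ Ioo (-Θ) Θ, lap2 h p = 0)
    (hbc : ∀ θ ∈ Icc (-Θ) Θ, h (0, θ) = 0 ∧ h (1, θ) = 0)
    (hside : ∀ t ∈ Icc (0:ℝ) 1, |h (t, Θ)| ≤ M ∧ |h (t, -Θ)| ≤ M) :
    (∀ t ∈ Icc (0:ℝ) 1, ∀ θ ∈ Icc (-2:ℝ) 2,
      |h (t, θ)| ≤ 2 * M * Real.sin (π/4 + π * t / 2) *
          Real.cosh (π * θ / 2) / Real.cosh (π * Θ / 2) ∧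
      |h (t, θ)| ≤ 2 * Real.cosh π * M / Real.cosh (π * Θ / 2)) ∧
    Tendsto (fun T : ℝ => 2 * Real.cosh π * M / Real.cosh (π * T / 2))
      atTop (nhds 0) := by
  have A : ∀ t ∈ Icc (0:ℝ) 1, ∀ θ ∈ Icc (-2:ℝ) 2,
      |h (t, θ)| ≤ 2 * M * Real.sin (π/4 + π * t / 2) *
          Real.cosh (π * θ / 2) / Real.cosh (π * Θ / 2) := by
    intro t ht θ hθ
    have hθ' : θ ∈ Icc (-Θ) Θ := ⟨by linarith [hθ.1], by linarith [hθ.2]⟩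
    have u := one_sided Θ M hM h hcont hC2 hharm
      (fun r hr => ⟨(hbc r hr).1.le, (hbc r hr).2.le⟩)
      (fun s hs => ⟨(abs_le.1 (hside s hs).1).2, (abs_le.1 (hside s hs).2).2⟩) t ht θ hθ'
    have v := one_sided Θ M hM (fun q => - h q) hcont.neg hC2.neg
      (fun p hp => by
        have e := hharm p hp
        simp only [lap2, deriv.fun_neg'] at e ⊢
        linarith)
      (fun r hr => ⟨by simp [(hbc r hr).1], by simp [(hbc r hr).2]⟩)
      (fun s hs => ⟨by linarith [(abs_le.1 (hside s hs).1).1],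
        by linarith [(abs_le.1 (hside s hs).2).1]⟩) t ht θ hθ'
    exact abs_le.2 ⟨by linarith, u⟩
  refine ⟨fun t ht θ hθ => ⟨A t ht θ hθ, (A t ht θ hθ).trans ?_⟩, ?_⟩
  · have hp := Real.pi_pos
    have hc : Real.cosh (π * θ / 2) ≤ Real.cosh π := by
      rw [Real.cosh_le_cosh, abs_of_pos hp, abs_le]
      constructor <;> nlinarith [hθ.1, hθ.2]
    have h1 := Real.sin_le_one (π/4 + π * t / 2)
    have h2 := Real.cosh_pos (π * Θ / 2)
    have h3 := Real.cosh_pos (π * θ / 2)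
    apply div_le_div_of_nonneg_right _ h2.le
    calc 2 * M * Real.sin (π/4 + π * t / 2) * Real.cosh (π * θ / 2)
        ≤ 2 * M * 1 * Real.cosh π := by gcongr
      _ = 2 * Real.cosh π * M := by ring
  · apply Tendsto.div_atTop tendsto_const_nhds
    have hp := Real.pi_pos
    have hlin : Tendsto (fun T : ℝ => π * T / 2 / 2) atTop atTop := by
      have : Tendsto (fun T : ℝ => π / 4 * T) atTop atTop :=
        tendsto_id.const_mul_atTop (by positivity)
      refine this.congr fun T => by ring
    refine tendsto_atTop_mono (fun T => ?_) hlin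
    have e1 := Real.add_one_le_exp (π * T / 2)
    have e2 := Real.exp_pos (-(π * T / 2))
    rw [Real.cosh_eq]
    linarith
end

section
/- Let h : [0,1] × ℝ → ℝ be a bounded continuous function which is harmonic in the open strip (0,1) × ℝ, i.e. twice continuously differentiable there with ∂²h/∂t² + ∂²h/∂θ² = 0, and which vanishes on the two boundary lines {0} × ℝ and {1} × ℝ. Then h is identically zero. -/
open Set

open Filter Topology in
lemma aux_second (f : ℝ → ℝ) (x : ℝ) (hm : IsLocalMax f x) (hc : ContinuousAt f x) :
    deriv (deriv f) x ≤ 0 := by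
  by_contra hlt
  push Not at hlt
  have hmin := isLocalMin_of_deriv_deriv_pos hlt hm.deriv_eq_zero hc
  have he : f =ᶠ[𝓝 x] fun _ => f x := by
    filter_upwards [hm, hmin] with y h1 h2
    exact le_antisymm h1 h2
  have h2 := he.deriv.deriv_eq
  simp at h2
  linarith

open Filter Topology in
lemma aux_quad (u : ℝ → ℝ) (x a b : ℝ) (hu : ContDiffAt ℝ 2 u x)
    (hm : IsLocalMax (fun s => u s + (a * s ^ 2 + b)) x) :
    deriv (deriv u) x + 2 * a ≤ 0 := by
  have h0 := aux_second _ x hm (hu.continuousAt.add (by fun_prop))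
  have hev : ∀ᶠ y in 𝓝 x, ContDiffAt ℝ 2 u y := hu.eventually (by simp)
  have he : deriv (fun s => u s + (a * s ^ 2 + b)) =ᶠ[𝓝 x] fun s => deriv u s + 2 * a * s := by
    filter_upwards [hev] with y hy
    have h1 : HasDerivAt u (deriv u y) y := (hy.differentiableAt (by simp)).hasDerivAt
    have h2 : HasDerivAt (fun s : ℝ => a * s ^ 2 + b) (a * (2 * y)) y := by
      simpa using ((hasDerivAt_pow 2 y).const_mul a).add_const b
    rw [(h1.fun_add h2).deriv]; ring
  rw [he.deriv_eq] at h0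
  have hd : DifferentiableAt ℝ (deriv u) x := by
    have h3 : ContDiffAt ℝ 1 (deriv u) x := by
      obtain ⟨s, hs, hus⟩ := hu.contDiffOn (m := 2) le_rfl (by simp)
      obtain ⟨o, hos, ho, hxo⟩ := mem_nhds_iff.1 (show s ∈ 𝓝 x by simpa using hs)
      exact ((hus.mono hos).deriv_of_isOpen ho (by norm_num)).contDiffAt (ho.mem_nhds hxo)
    exact h3.differentiableAt (by simp)
  have h2 : HasDerivAt (fun s : ℝ => 2 * a * s) (2 * a) x := by
    simpa using (hasDerivAt_id x).const_mul (2 * a)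
  rw [(hd.hasDerivAt.fun_add h2).deriv] at h0
  exact h0

open Filter Topology in
lemma aux_upper (h : ℝ × ℝ → ℝ)
    (hcont : ContinuousOn h (Icc (0:ℝ) 1 ×ˢ (univ : Set ℝ)))
    (hbdd : ∃ C : ℝ, ∀ t ∈ Icc (0:ℝ) 1, ∀ θ : ℝ, |h (t, θ)| ≤ C)
    (hC2 : ContDiffOn ℝ 2 h (Ioo (0:ℝ) 1 ×ˢ (univ : Set ℝ)))
    (hharm : ∀ p ∈ Ioo (0:ℝ) 1 ×ˢ (univ : Set ℝ), lap2 h p = 0)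
    (hbc : ∀ θ : ℝ, h (0, θ) = 0 ∧ h (1, θ) = 0) :
    ∀ t ∈ Icc (0:ℝ) 1, ∀ θ : ℝ, h (t, θ) ≤ 0 := by
  obtain ⟨C, hC⟩ := hbdd
  intro t₀ ht₀ θ₀
  have key : ∀ ε > 0, h (t₀, θ₀) ≤ ε * (θ₀ ^ 2 + 2 - 2 * t₀ ^ 2) := by
    intro ε hε
    by_contra hlt
    push Not at hlt
    have hC0 : 0 ≤ C := (abs_nonneg _).trans (hC t₀ ht₀ θ₀)
    set R := |θ₀| + 1 + C / ε with hR
    have hCε : 0 ≤ C / ε := by positivity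
    have hR1 : 1 ≤ R := by have := abs_nonneg θ₀; linarith
    have hRC : C ≤ ε * R ^ 2 := by
      have h1 : C / ε ≤ R := by have := abs_nonneg θ₀; linarith
      have h2 : C ≤ ε * R := by rw [div_le_iff₀ hε] at h1; linarith
      nlinarith
    have hθ₀ : θ₀ ∈ Icc (-R) R := by
      rw [mem_Icc, ← abs_le]; linarith
    let v : ℝ × ℝ → ℝ := fun p => h p - ε * (p.2 ^ 2 + 2 - 2 * p.1 ^ 2)
    have hvc : ContinuousOn v (Icc (0:ℝ) 1 ×ˢ Icc (-R) R) :=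
      (hcont.mono (prod_mono_right (subset_univ _))).sub (by fun_prop)
    obtain ⟨⟨t, θ⟩, hp, hmax⟩ := (isCompact_Icc.prod isCompact_Icc).exists_isMaxOn
      ⟨(t₀, θ₀), ht₀, hθ₀⟩ hvc
    obtain ⟨ht, hθ⟩ := hp
    simp only at ht hθ
    have hpos : 0 < h (t, θ) - ε * (θ ^ 2 + 2 - 2 * t ^ 2) := by
      have h1 : v (t₀, θ₀) ≤ v (t, θ) := hmax (show (t₀, θ₀) ∈ _ from ⟨ht₀, hθ₀⟩)
      simp only [v] at h1
      linarith
    have ht2 : t ^ 2 ≤ 1 := by nlinarith [ht.1, ht.2]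
    have hw : 0 ≤ ε * (2 - 2 * t ^ 2) := mul_nonneg hε.le (by linarith)
    have hw2 : 0 ≤ ε * θ ^ 2 := by positivity
    have hti : t ∈ Ioo (0:ℝ) 1 := by
      refine ⟨lt_of_le_of_ne ht.1 ?_, lt_of_le_of_ne ht.2 ?_⟩
      · rintro rfl
        have := (hbc θ).1; nlinarith
      · rintro rfl
        have := (hbc θ).2; nlinarith
    have hθR : θ ^ 2 ≠ R ^ 2 := by
      intro he
      rw [he] at hpos
      have := (le_abs_self _).trans (hC t ht θ)
      nlinarith
    have hθi : θ ∈ Ioo (-R) R := by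
      refine ⟨lt_of_le_of_ne hθ.1 ?_, lt_of_le_of_ne hθ.2 ?_⟩
      · rintro rfl; simp at hθR
      · rintro rfl; simp at hθR
    have hmem : (t, θ) ∈ Ioo (0:ℝ) 1 ×ˢ (univ : Set ℝ) := ⟨hti, mem_univ _⟩
    have hcd : ContDiffAt ℝ 2 h (t, θ) :=
      hC2.contDiffAt ((isOpen_Ioo.prod isOpen_univ).mem_nhds hmem)
    have e1 := aux_quad (fun s => h (s, θ)) t (2 * ε) (-ε * (θ ^ 2 + 2))
      (ContDiffAt.comp t (g := h) (f := fun s : ℝ => (s, θ)) hcd (by fun_prop)) (by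
        filter_upwards [isOpen_Ioo.mem_nhds hti] with s hs
        have h1 : v (s, θ) ≤ v (t, θ) := hmax (show (s, θ) ∈ _ from ⟨Ioo_subset_Icc_self hs, hθ⟩)
        simp only [v] at h1
        linarith)
    have e2 := aux_quad (fun s => h (t, s)) θ (-ε) (-ε * (2 - 2 * t ^ 2))
      (ContDiffAt.comp θ (g := h) (f := fun s : ℝ => (t, s)) hcd (by fun_prop)) (by
        filter_upwards [isOpen_Ioo.mem_nhds hθi] with s hs
        have h1 : v (t, s) ≤ v (t, θ) := hmax (show (t, s) ∈ _ from ⟨ht, Ioo_subset_Icc_self hs⟩)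
        simp only [v] at h1
        linarith)
    have e3 := hharm _ hmem
    simp only [lap2] at e3
    linarith
  have hlim : Tendsto (fun ε : ℝ => ε * (θ₀ ^ 2 + 2 - 2 * t₀ ^ 2)) (𝓝[>] 0) (𝓝 0) := by
    have : Tendsto (fun ε : ℝ => ε * (θ₀ ^ 2 + 2 - 2 * t₀ ^ 2)) (𝓝 0)
        (𝓝 (0 * (θ₀ ^ 2 + 2 - 2 * t₀ ^ 2))) := Continuous.tendsto (by fun_prop) 0
    rw [zero_mul] at this
    exact this.mono_left nhdsWithin_le_nhds
  exact ge_of_tendsto hlim (by filter_upwards [self_mem_nhdsWithin] with ε hε using key ε hε)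

/-- Liouville-type theorem on the infinite strip: a bounded continuous function
on `[0,1] × ℝ`, harmonic in the open strip and vanishing on the two boundary
lines, is identically zero. -/
theorem strip_liouville (h : ℝ × ℝ → ℝ)
    (hcont : ContinuousOn h (Icc (0:ℝ) 1 ×ˢ (univ : Set ℝ)))
    (hbdd : ∃ C : ℝ, ∀ t ∈ Icc (0:ℝ) 1, ∀ θ : ℝ, |h (t, θ)| ≤ C)
    (hC2 : ContDiffOn ℝ 2 h (Ioo (0:ℝ) 1 ×ˢ (univ : Set ℝ)))
    (hharm : ∀ p ∈ Ioo (0:ℝ) 1 ×ˢ (univ : Set ℝ), lap2 h p = 0)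
    (hbc : ∀ θ : ℝ, h (0, θ) = 0 ∧ h (1, θ) = 0) :
    ∀ t ∈ Icc (0:ℝ) 1, ∀ θ : ℝ, h (t, θ) = 0 := by
  intro t ht θ
  refine le_antisymm (aux_upper h hcont hbdd hC2 hharm hbc t ht θ) ?_
  have := aux_upper (fun p => - h p) hcont.neg (by simpa using hbdd) hC2.neg (by
    intro p hp
    have h1 := hharm p hp
    simp only [lap2] at h1 ⊢
    simp only [deriv.fun_neg']
    linarith) (by simpa using hbc) t ht θ
  linarith
end

section
/- (Harnack contraction for odd-symmetric harmonic functions.) There exists a constant δ ∈ (0,1) with the following property: for every function h continuous on [-1,2] × [-3,3] ⊂ ℝ² and harmonic in the open rectangle (-1,2) × (-3,3) (twice continuously differentiable there with ∂²h/∂t² + ∂²h/∂θ² = 0), satisfying the odd symmetries h(-t, θ) = -h(t, θ) for all (t, θ) with t ∈ [0,1], θ ∈ [-3,3], and h(2 - t, θ) = -h(t, θ) for all (t, θ) with t ∈ [0,2], θ ∈ [-3,3], one has max over the subrectangle [-1/2, 3/2] × [-2,2] of |h| ≤ ((1-δ)/(1+δ)) · max over [-1,2] × [-3,3] of |h|.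 -/
open Set

open Filter Topology

lemma aux_second_deriv {g : ℝ → ℝ} {a : ℝ} (hg : ContinuousAt g a) (hm : IsLocalMax g a) :
    deriv (deriv g) a ≤ 0 := by
  by_contra hc
  push Not at hc
  have hmin := isLocalMin_of_deriv_deriv_pos hc hm.deriv_eq_zero hg
  have he : g =ᶠ[𝓝 a] fun _ => g a := by
    filter_upwards [hm, hmin] with x h1 h2
    exact le_antisymm h1 h2
  have h2 : deriv (deriv g) a = 0 := by
    rw [he.deriv.deriv_eq]
    simp
  linarith

lemma aux_quad_s13 {f : ℝ → ℝ} {a A B C : ℝ} (hf : ContDiffAt ℝ 2 f a)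
    (hm : IsLocalMax (fun s => f s - (A + B * s + C * s ^ 2)) a) :
    deriv (deriv f) a ≤ 2 * C := by
  have hq : ∀ s, HasDerivAt (fun s : ℝ => A + B * s + C * s ^ 2) (B + 2 * C * s) s := by
    intro s
    have := (((hasDerivAt_id s).const_mul B).const_add A).add
      (((hasDerivAt_id s).pow 2).const_mul C)
    refine (this.congr_deriv ?_)
    simp
    ring
  have h1 := aux_second_deriv (g := fun s => f s - (A + B * s + C * s ^ 2))
    (hf.continuousAt.sub (hq a).continuousAt) hm
  have hev : ∀ᶠ s in 𝓝 a, DifferentiableAt ℝ f s := by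
    filter_upwards [hf.eventually (by simp)] with s hs
    exact hs.differentiableAt (by simp)
  have he : deriv (fun s => f s - (A + B * s + C * s ^ 2)) =ᶠ[𝓝 a]
      fun s => deriv f s - (B + 2 * C * s) := by
    filter_upwards [hev] with s hs
    exact (hs.hasDerivAt.sub (hq s)).deriv
  have hdd : DifferentiableAt ℝ (deriv f) a :=
    (ContDiffAt.fderiv_right (m := 1) hf (by norm_num)).differentiableAt (by simp) |>.clm_apply (differentiableAt_const (1:ℝ))
  have hl : HasDerivAt (fun s : ℝ => B + 2 * C * s) (2 * C) a := by
    simpa using ((hasDerivAt_id a).const_mul (2 * C)).const_add B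
  rw [he.deriv_eq, (hdd.hasDerivAt.fun_sub hl).deriv] at h1
  linarith

lemma aux_barrier {h : ℝ × ℝ → ℝ} {M : ℝ} (hM : 0 < M)
    (hc : ContinuousOn h (Icc (-1:ℝ) 2 ×ˢ Icc (-3:ℝ) 3))
    (hd : ContDiffOn ℝ 2 h (Ioo (-1:ℝ) 2 ×ˢ Ioo (-3:ℝ) 3))
    (hl : ∀ p ∈ Ioo (-1:ℝ) 2 ×ˢ Ioo (-3:ℝ) 3, lap2 h p = 0)
    (hb : ∀ p ∈ Icc (-1:ℝ) 2 ×ˢ Icc (-3:ℝ) 3, h p ≤ M)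
    (h1 : ∀ θ ∈ Icc (-3:ℝ) 3, h (-1, θ) = 0)
    (h2 : ∀ θ ∈ Icc (-3:ℝ) 3, h (2, θ) = 0) :
    ∀ p ∈ Icc (-1:ℝ) 2 ×ˢ Icc (-3:ℝ) 3,
      h p ≤ M * (p.2 ^ 2 / 9 + 2 / 9 * ((p.1 + 1) * (2 - p.1))) := by
  set w : ℝ × ℝ → ℝ := fun p => M * (p.2 ^ 2 / 9 + 2 / 9 * ((p.1 + 1) * (2 - p.1))) with hw
  have hwc : Continuous w := by fun_prop
  obtain ⟨q, hqK, hq⟩ := (isCompact_Icc.prod isCompact_Icc).exists_isMaxOn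
    (s := Icc (-1:ℝ) 2 ×ˢ Icc (-3:ℝ) 3)
    ⟨((0:ℝ), (0:ℝ)), by constructor <;> constructor <;> norm_num⟩ (hc.sub hwc.continuousOn)
  suffices hs : h q - w q ≤ 0 by
    intro p hp
    have : h p - w p ≤ h q - w q := hq hp
    change h p ≤ w p
    linarith
  obtain ⟨t, θ⟩ := q
  obtain ⟨⟨ht1, ht2⟩, ⟨hθ1, hθ2⟩⟩ := hqK
  simp only at ht1 ht2 hθ1 hθ2
  have hbq := hb (t, θ) ⟨⟨ht1, ht2⟩, ⟨hθ1, hθ2⟩⟩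
  have hnn : 0 ≤ (t + 1) * (2 - t) := mul_nonneg (by linarith) (by linarith)
  have hMn := mul_nonneg hM.le hnn
  simp only [hw]
  rcases eq_or_lt_of_le ht1 with e | ht1'
  · subst e
    rw [h1 θ ⟨hθ1, hθ2⟩]
    have := mul_nonneg hM.le (sq_nonneg θ)
    linarith
  rcases eq_or_lt_of_le ht2 with e | ht2'
  · subst e
    rw [h2 θ ⟨hθ1, hθ2⟩]
    have := mul_nonneg hM.le (sq_nonneg θ)
    linarith
  rcases eq_or_lt_of_le hθ1 with e | hθ1'
  · subst e
    linarith
  rcases eq_or_lt_of_le hθ2 with e | hθ2'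
  · subst e
    linarith
  exfalso
  have hint : ((t, θ) : ℝ × ℝ) ∈ Ioo (-1:ℝ) 2 ×ˢ Ioo (-3:ℝ) 3 := ⟨⟨ht1', ht2'⟩, ⟨hθ1', hθ2'⟩⟩
  have hnhd : Ioo (-1:ℝ) 2 ×ˢ Ioo (-3:ℝ) 3 ∈ 𝓝 ((t, θ) : ℝ × ℝ) :=
    (isOpen_Ioo.prod isOpen_Ioo).mem_nhds hint
  have hda : ContDiffAt ℝ 2 h (t, θ) := hd.contDiffAt hnhd
  have hlap := hl _ hint
  simp only [lap2] at hlap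
  have a1 : deriv (deriv (fun s => h (s, θ))) t ≤ 2 * (-(2 * M / 9)) := by
    apply aux_quad_s13 (A := M * (θ ^ 2 / 9 + 4 / 9)) (B := 2 * M / 9)
    · exact hda.comp t (contDiffAt_id.prodMk contDiffAt_const)
    · filter_upwards [isOpen_Ioo.mem_nhds (show t ∈ Ioo (-1:ℝ) 2 from ⟨ht1', ht2'⟩)] with s hs
      have := hq (show ((s, θ) : ℝ × ℝ) ∈ _ from ⟨⟨hs.1.le, hs.2.le⟩, ⟨hθ1, hθ2⟩⟩)
      simp only [hw, mem_setOf_eq, Pi.sub_apply] at this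
      linarith
  have a2 : deriv (deriv (fun s => h (t, s))) θ ≤ 2 * (M / 9) := by
    apply aux_quad_s13 (A := M * (2 / 9 * ((t + 1) * (2 - t)))) (B := 0)
    · exact hda.comp θ (contDiffAt_const.prodMk contDiffAt_id)
    · filter_upwards [isOpen_Ioo.mem_nhds (show θ ∈ Ioo (-3:ℝ) 3 from ⟨hθ1', hθ2'⟩)] with s hs
      have := hq (show ((t, s) : ℝ × ℝ) ∈ _ from ⟨⟨ht1, ht2⟩, ⟨hs.1.le, hs.2.le⟩⟩)
      simp only [hw, mem_setOf_eq, Pi.sub_apply] at this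
      linarith
  linarith

/-- Harnack contraction for odd-symmetric harmonic functions: there is a
universal `δ ∈ (0,1)` such that every harmonic function on
`(-1,2) × (-3,3)`, continuous up to the boundary and odd under reflection
across `{t=0}` and `{t=1}`, satisfies
`max_{[-1/2,3/2]×[-2,2]} |h| ≤ ((1-δ)/(1+δ)) max_{[-1,2]×[-3,3]} |h|`. -/
theorem harnack_contraction_odd_symmetric :
    ∃ δ : ℝ, 0 < δ ∧ δ < 1 ∧
      ∀ h : ℝ × ℝ → ℝ,
        ContinuousOn h (Icc (-1:ℝ) 2 ×ˢ Icc (-3:ℝ) 3) →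
        ContDiffOn ℝ 2 h (Ioo (-1:ℝ) 2 ×ˢ Ioo (-3:ℝ) 3) →
        (∀ p ∈ Ioo (-1:ℝ) 2 ×ˢ Ioo (-3:ℝ) 3, lap2 h p = 0) →
        (∀ t ∈ Icc (0:ℝ) 1, ∀ θ ∈ Icc (-3:ℝ) 3, h (-t, θ) = - h (t, θ)) →
        (∀ t ∈ Icc (0:ℝ) 2, ∀ θ ∈ Icc (-3:ℝ) 3, h (2 - t, θ) = - h (t, θ)) →
        ∀ p ∈ Icc (-(1:ℝ)/2) (3/2) ×ˢ Icc (-2:ℝ) 2,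
          |h p| ≤ (1 - δ)/(1 + δ) *
            sSup ((fun q => |h q|) '' (Icc (-1:ℝ) 2 ×ˢ Icc (-3:ℝ) 3)) := by
  refine ⟨1 / 35, by norm_num, by norm_num, ?_⟩
  intro h hc hd hl s1 s2 p hp
  have hcon : ((1:ℝ) - 1 / 35) / (1 + 1 / 35) = 17 / 18 := by norm_num
  rw [hcon]
  set M := sSup ((fun q => |h q|) '' (Icc (-1:ℝ) 2 ×ˢ Icc (-3:ℝ) 3)) with hMdef
  have hbdd : BddAbove ((fun q => |h q|) '' (Icc (-1:ℝ) 2 ×ˢ Icc (-3:ℝ) 3)) :=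
    ((isCompact_Icc.prod isCompact_Icc).image_of_continuousOn hc.abs).bddAbove
  have hb : ∀ q ∈ Icc (-1:ℝ) 2 ×ˢ Icc (-3:ℝ) 3, |h q| ≤ M :=
    fun q hq => le_csSup hbdd ⟨q, hq, rfl⟩
  obtain ⟨⟨ht1, ht2⟩, ⟨hθ1, hθ2⟩⟩ := hp
  have hpK : p ∈ Icc (-1:ℝ) 2 ×ˢ Icc (-3:ℝ) 3 :=
    ⟨⟨by linarith, by linarith⟩, ⟨by linarith, by linarith⟩⟩
  have hM0 : 0 ≤ M := (abs_nonneg _).trans (hb p hpK)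
  rcases eq_or_lt_of_le hM0 with e | hM
  · have := hb p hpK
    rw [← e] at this ⊢
    simpa using this
  have z1 : ∀ θ ∈ Icc (-3:ℝ) 3, h (-1, θ) = 0 := by
    intro θ hθ
    have e1 := s1 1 (by norm_num) θ hθ
    have e2 := s2 1 (by norm_num) θ hθ
    norm_num at e2
    linarith
  have z2 : ∀ θ ∈ Icc (-3:ℝ) 3, h (2, θ) = 0 := by
    intro θ hθ
    have e1 := s1 0 (by norm_num) θ hθ
    have e2 := s2 0 (by norm_num) θ hθ
    norm_num at e1 e2
    linarith
  have b1 := aux_barrier hM hc hd hl (fun q hq => (le_abs_self _).trans (hb q hq)) z1 z2 p hpK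
  have b2 := aux_barrier (h := fun q => - h q) hM hc.neg hd.neg
    (fun q hq => by
      have := hl q hq
      simp only [lap2, deriv.fun_neg', deriv.fun_neg] at this ⊢
      linarith)
    (fun q hq => (neg_le_abs _).trans (hb q hq))
    (fun θ hθ => by simp [z1 θ hθ]) (fun θ hθ => by simp [z2 θ hθ]) p hpK
  have hw : p.2 ^ 2 / 9 + 2 / 9 * ((p.1 + 1) * (2 - p.1)) ≤ 17 / 18 := by
    nlinarith [sq_nonneg (p.1 - 1 / 2), mul_nonneg (sub_nonneg.2 hθ1) (sub_nonneg.2 hθ2)]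
  have := mul_le_mul_of_nonneg_left hw hM0
  rw [abs_le]
  constructor <;> linarith
end

section
/- (Two-norm integral representation.) Let X and Y be real Banach spaces and ι : X → Y a continuous injective linear map. Let Φ : [0,1] → X be a function, let H : [0,1] → X be continuous with respect to the norm of X, and let C > 0 be such that for all λ, ν ∈ [0,1], ‖ι(Φ(λ) - Φ(ν) - (λ - ν) H(ν))‖_Y ≤ C (λ - ν)². Then Φ(1) - Φ(0) = ∫₀¹ H(λ) dλ, where the integral is the Bochner integral of the continuous X-valued function H; in particular ‖Φ(1) - Φ(0)‖_X ≤ sup_{λ ∈ [0,1]} ‖H(λ)‖_X. -/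
open Set

/-- Two-norm integral representation: if `Φ : [0,1] → X` admits a quadratic
linear approximation by a continuous family `H : [0,1] → X` measured in a
weaker norm (through a continuous injective embedding `ι : X → Y`), then
`Φ(1) - Φ(0) = ∫₀¹ H(λ) dλ` in `X`; in particular
`‖Φ(1) - Φ(0)‖_X ≤ sup_{λ∈[0,1]} ‖H(λ)‖_X`. -/
theorem two_norm_integral_representation
    {X Y : Type*} [NormedAddCommGroup X] [NormedSpace ℝ X] [CompleteSpace X]
    [NormedAddCommGroup Y] [NormedSpace ℝ Y] [CompleteSpace Y]
    (ι : X →L[ℝ] Y) (hι : Function.Injective ι)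
    (Φ H : ℝ → X) (hH : ContinuousOn H (Icc (0:ℝ) 1))
    (C : ℝ) (hC : 0 < C)
    (hquad : ∀ lam ∈ Icc (0:ℝ) 1, ∀ nu ∈ Icc (0:ℝ) 1,
      ‖ι (Φ lam - Φ nu - (lam - nu) • H nu)‖ ≤ C * (lam - nu)^2) :
    (Φ 1 - Φ 0 = ∫ lam in (0:ℝ)..1, H lam) ∧
    ‖Φ 1 - Φ 0‖ ≤ sSup ((fun lam => ‖H lam‖) '' Icc (0:ℝ) 1) := by
  have hd : ∀ x ∈ Icc (0:ℝ) 1, HasDerivWithinAt (fun t => ι (Φ t)) (ι (H x)) (Icc 0 1) x := by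
    intro x hx
    rw [hasDerivWithinAt_iff_isLittleO]
    have h1 : (fun t => ι (Φ t) - ι (Φ x) - (t - x) • ι (H x))
        =O[nhdsWithin x (Icc 0 1)] fun t => (t - x) ^ 2 := by
      refine Asymptotics.IsBigO.of_bound C ?_
      filter_upwards [self_mem_nhdsWithin] with t ht
      have := hquad t ht x hx
      rw [map_sub, map_sub, map_smul] at this
      rwa [Real.norm_of_nonneg (sq_nonneg _)]
    refine h1.trans_isLittleO ?_
    have h2 : (fun t : ℝ => (t - x) ^ 2) =o[nhds x] fun t => t - x :=
      by
        have h3 := Asymptotics.isLittleO_pow_sub_sub x (m := 2) (by norm_num)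
        refine h3.congr_left fun t => ?_
        simp
    exact h2.mono nhdsWithin_le_nhds
  have hint : IntervalIntegrable H MeasureTheory.volume 0 1 :=
    ContinuousOn.intervalIntegrable_of_Icc zero_le_one hH
  have hιH : ContinuousOn (fun t => ι (H t)) (Icc 0 1) := ι.continuous.comp_continuousOn hH
  have hftc : ∫ t in (0:ℝ)..1, ι (H t) = ι (Φ 1) - ι (Φ 0) :=
    intervalIntegral.integral_eq_sub_of_hasDerivAt_of_le zero_le_one
      (fun x hx => (hd x hx).continuousWithinAt)
      (fun x hx => (hd x (Ioo_subset_Icc_self hx)).hasDerivAt (Icc_mem_nhds hx.1 hx.2))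
      (ContinuousOn.intervalIntegrable_of_Icc zero_le_one hιH)
  have hmain : Φ 1 - Φ 0 = ∫ lam in (0:ℝ)..1, H lam := by
    apply hι
    rw [map_sub, ← hftc]
    exact ι.intervalIntegral_comp_comm hint
  refine ⟨hmain, ?_⟩
  have hb : BddAbove ((fun lam => ‖H lam‖) '' Icc (0:ℝ) 1) :=
    (isCompact_Icc.image_of_continuousOn hH.norm).bddAbove
  rw [hmain]
  have := intervalIntegral.norm_integral_le_of_norm_le_const (a := 0) (b := 1) (f := H)
    (C := sSup ((fun lam => ‖H lam‖) '' Icc (0:ℝ) 1)) (by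
      intro x hx
      rw [uIoc_of_le zero_le_one] at hx
      exact le_csSup hb ⟨x, Ioc_subset_Icc_self hx, rfl⟩)
  simpa using this
end
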